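/- Let T be a 2-tree on [n−1]. Then the greatest common divisor, in the polynomial ring ℂ[x_1,…,x_{n−3}], of the maximal (size (n−2)×(n−2)) minors of the matrix M_T equals, up to a nonzero constant, Π_e p_{ij}(x)^{ṽ(e)−1}, the product over all edges e = {i,j} contained in at least one triple of the on-shell diagram of T. -/

import Mathlib

namespace MinKin

noncomputable section

attribute [local instance] Classical.propDecidable

open scoped BigOperators

/-- First row of the 2×n matrix X, at column `j` (1-based). -/
def colA (n j : ℕ) : ℂ := if j = n then 0 else 1

/-- Second row of X at column `j` (1-based): `(0,1,x_1,…,x_{n-3},1)`. -/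
def colB (n : ℕ) (x : Fin (n - 3) → ℂ) (j : ℕ) : ℂ :=
  if j = 1 then 0
  else if j = 2 then 1
  else if j = n then 1
  else if h : j - 3 < n - 3 then x ⟨j - 3, h⟩ else 0

/-- The Plücker coordinate `p_{ij}(x)`, the 2×2 minor of X on columns i and j. -/
def pc (n : ℕ) (x : Fin (n - 3) → ℂ) (i j : ℕ) : ℂ :=
  colA n i * colB n x j - colA n j * colB n x i

/-- The partial derivative `∂p_{ij}/∂x_m` (with `m : Fin (n-3)` zero-based, so that
the variable `x m` appears in column `(m:ℕ)+3` of X). -/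
def dpc (n : ℕ) (i j : ℕ) (m : Fin (n - 3)) : ℂ :=
  colA n i * (if j = (m : ℕ) + 3 then (1 : ℂ) else 0)
    - colA n j * (if i = (m : ℕ) + 3 then (1 : ℂ) else 0)

/-- The index set `S = {(i,j) : 1 ≤ i < j ≤ n-1, (i,j) ≠ (1,2)}`. -/
def Sfin (n : ℕ) : Finset (ℕ × ℕ) :=
  ((Finset.Icc 1 (n - 1)) ×ˢ (Finset.Icc 1 (n - 1))).filter
    (fun e => e.1 < e.2 ∧ e ≠ (1, 2))

/-- The domain `U = {x : p_{ij}(x) ≠ 0 for all (i,j) ∈ S}`. -/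
def Udom (n : ℕ) : Set (Fin (n - 3) → ℂ) :=
  {x | ∀ e ∈ Sfin n, pc n x e.1 e.2 ≠ 0}

/-- `x` is a critical point of `L_{T₀} = Σ_{e ∈ T₀} s_e · log p_e`. -/
def IsCrit (n : ℕ) (T₀ : Finset (ℕ × ℕ)) (s : ℕ × ℕ → ℂ) (x : Fin (n - 3) → ℂ) : Prop :=
  ∀ m : Fin (n - 3), ∑ e ∈ T₀, s e * dpc n e.1 e.2 m / pc n x e.1 e.2 = 0

/-- Edge sets built inductively from the parent choices `par`. -/
def edgesUpTo (par : ℕ → ℕ × ℕ) : ℕ → Finset (ℕ × ℕ)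
  | 0 => {(1, 2)}
  | k + 1 =>
      if k + 1 < 3 then {(1, 2)}
      else edgesUpTo par k ∪ {((par (k + 1)).1, k + 1), ((par (k + 1)).2, k + 1)}

/-- A 2-tree on `[n-1]`: for each `k = 3,…,n-1` an already-present edge
`par k = (i_k, j_k)` with `i_k < j_k ≤ k-1` is chosen, and the edges
`(i_k, k)` and `(j_k, k)` are added. -/
structure TwoTree (n : ℕ) : Type where
  par : ℕ → ℕ × ℕ
  lt : ∀ k, 3 ≤ k → k ≤ n - 1 → (par k).1 < (par k).2 ∧ (par k).2 < k
  mem : ∀ k, 3 ≤ k → k ≤ n - 1 → par k ∈ edgesUpTo par (k - 1)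

/-- The edge set of a 2-tree. -/
def TwoTree.edges {n : ℕ} (T : TwoTree n) : Finset (ℕ × ℕ) := edgesUpTo T.par (n - 1)

/-- A finite edge set is a 2-tree on `[n-1]`. -/
def IsTwoTree (n : ℕ) (E : Finset (ℕ × ℕ)) : Prop := ∃ T : TwoTree n, T.edges = E

/-- `c` is a child of `e` in the 2-tree `T`. -/
def Child (n : ℕ) (T : TwoTree n) (e c : ℕ × ℕ) : Prop :=
  ∃ k, 3 ≤ k ∧ k ≤ n - 1 ∧ T.par k = e ∧ (c = (e.1, k) ∨ c = (e.2, k))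

/-- The set `dec(e)` of descendants of the edge `e` (including `e` itself). -/
def dec (n : ℕ) (T : TwoTree n) (e : ℕ × ℕ) : Finset (ℕ × ℕ) :=
  T.edges.filter (fun f => Relation.ReflTransGen (Child n T) e f)

/-- The bracket `[s_e] = Σ_{f ∈ dec(e)} s_f`. -/
def brk (n : ℕ) (T : TwoTree n) (s : ℕ × ℕ → ℂ) (e : ℕ × ℕ) : ℂ :=
  ∑ f ∈ dec n T e, s f

/-- The Mandelstam invariants `s` are generic for `T`. -/
def Generic (n : ℕ) (T : TwoTree n) (s : ℕ × ℕ → ℂ) : Prop :=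
  ∀ k, 3 ≤ k → k ≤ n - 1 →
    brk n T s ((T.par k).1, k) ≠ 0 ∧ brk n T s ((T.par k).2, k) ≠ 0 ∧
      brk n T s ((T.par k).1, k) + brk n T s ((T.par k).2, k) ≠ 0

/-- `a_e = |dec(e)|`. -/
def aA (n : ℕ) (T : TwoTree n) (e : ℕ × ℕ) : ℕ := (dec n T e).card

/-- `v_T(e)`: the number of triangles of `T` containing the edge `e`. -/
def vT (n : ℕ) (T : TwoTree n) (e : ℕ × ℕ) : ℕ :=
  ((Finset.Icc 3 (n - 1)).filter
    (fun k => e = T.par k ∨ e = ((T.par k).1, k) ∨ e = ((T.par k).2, k))).card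

/-- The Horn product `P_e(s)`: over all ancestral triangles `{i,j,k}` of `e`, the
factor `[s_c]/([s_{(i,k)}]+[s_{(j,k)}])` where `c` is the child containing `e`
among its descendants. -/
def hornP (n : ℕ) (T : TwoTree n) (s : ℕ × ℕ → ℂ) (e : ℕ × ℕ) : ℂ :=
  ∏ k ∈ Finset.Icc 3 (n - 1),
    (if e ∈ dec n T ((T.par k).1, k) then
        brk n T s ((T.par k).1, k)
          / (brk n T s ((T.par k).1, k) + brk n T s ((T.par k).2, k))
      else if e ∈ dec n T ((T.par k).2, k) then
        brk n T s ((T.par k).2, k)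
          / (brk n T s ((T.par k).1, k) + brk n T s ((T.par k).2, k))
      else 1)

/-- Auxiliary recursion for the signs `ε_e`. -/
def epsAux (par : ℕ → ℕ × ℕ) : ℕ → ℕ × ℕ → ℂ
  | 0, _ => 1
  | k + 1, e =>
      if e = (1, 2) then 1
      else if e = ((par (k + 1)).1, k + 1) then epsAux par k (par (k + 1))
      else if e = ((par (k + 1)).2, k + 1) then -(epsAux par k (par (k + 1)))
      else epsAux par k e

/-- The sign `ε_e ∈ {1,-1}`: `ε_{(1,2)} = 1`, `ε_{(i,k)} = ε_{(i,j)}`,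
`ε_{(j,k)} = -ε_{(i,j)}` for each triangle `{i,j,k}`. -/
def eps (n : ℕ) (T : TwoTree n) (e : ℕ × ℕ) : ℂ := epsAux T.par (n - 1) e

/-- The negated Hessian matrix `𝓗(x) = -Hess(L_{T₀})(x)`. -/
def negHess (n : ℕ) (T₀ : Finset (ℕ × ℕ)) (s : ℕ × ℕ → ℂ) (x : Fin (n - 3) → ℂ) :
    Matrix (Fin (n - 3)) (Fin (n - 3)) ℂ :=
  Matrix.of fun (l m : Fin (n - 3)) =>
    ∑ e ∈ T₀, s e * dpc n e.1 e.2 l * dpc n e.1 e.2 m / pc n x e.1 e.2 ^ 2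

/-- The on-shell diagram of `T`: the triangles of `T` together with `(1,2,n)`. -/
def triples (n : ℕ) (T : TwoTree n) : Finset (ℕ × ℕ × ℕ) :=
  insert (1, 2, n) ((Finset.Icc 3 (n - 1)).image fun k => ((T.par k).1, (T.par k).2, k))

/-- The edge `e` is contained in the triple `t`. -/
def inTriple (e : ℕ × ℕ) (t : ℕ × ℕ × ℕ) : Prop :=
  e = (t.1, t.2.1) ∨ e = (t.1, t.2.2) ∨ e = (t.2.1, t.2.2)

/-- `ṽ(e)`: the number of triples of the on-shell diagram containing `e`. -/
def vTil (n : ℕ) (T : TwoTree n) (e : ℕ × ℕ) : ℕ :=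
  ((triples n T).filter (inTriple e)).card

/-- The edges contained in at least one triple of the on-shell diagram. -/
def diagEdges (n : ℕ) (T : TwoTree n) : Finset (ℕ × ℕ) :=
  (triples n T).biUnion fun t => {(t.1, t.2.1), (t.1, t.2.2), (t.2.1, t.2.2)}

/-- The CHY integrand `I_T(x) = Π_e p_e(x)^{ṽ(e)-2}`. -/
def integrand (n : ℕ) (T : TwoTree n) (x : Fin (n - 3) → ℂ) : ℂ :=
  ∏ e ∈ diagEdges n T, pc n x e.1 e.2 ^ ((vTil n T e : ℤ) - 2)

/-- The Horn matrix `H_T`: rows come in consecutive triples indexed by the triangles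
(in order k = 3,…,n-1), columns indexed by the non-initial edges of `T`
(in order (i_3,3),(j_3,3),(i_4,4),(j_4,4),…). -/
def HornMat (n : ℕ) (T : TwoTree n) : Matrix (Fin (3 * n - 9)) (Fin (2 * n - 6)) ℤ :=
  Matrix.of fun (ρ : Fin (3 * n - 9)) (c : Fin (2 * n - 6)) =>
    let k := (ρ : ℕ) / 3 + 3
    let c1 : ℕ × ℕ := ((T.par k).1, k)
    let c2 : ℕ × ℕ := ((T.par k).2, k)
    let kc := (c : ℕ) / 2 + 3
    let e : ℕ × ℕ := if (c : ℕ) % 2 = 0 then ((T.par kc).1, kc) else ((T.par kc).2, kc)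
    if (ρ : ℕ) % 3 = 0 then (if e ∈ dec n T c1 then 1 else 0)
    else if (ρ : ℕ) % 3 = 1 then (if e ∈ dec n T c2 then 1 else 0)
    else (if e ∈ dec n T c1 ∨ e ∈ dec n T c2 then -1 else 0)

/-- The matrix `A` whose r-th row has 1 in columns 3r-2, 3r-1, 3r (1-based). -/
def Amat (n : ℕ) : Matrix (Fin (n - 3)) (Fin (3 * n - 9)) ℤ :=
  Matrix.of fun (r : Fin (n - 3)) (c : Fin (3 * n - 9)) =>
    if (c : ℕ) / 3 = (r : ℕ) then 1 else 0

/-- Polynomial version of the first row of X. -/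
def colAP (n : ℕ) (j : ℕ) : MvPolynomial (Fin (n - 3)) ℂ := if j = n then 0 else 1

/-- Polynomial version of the second row of X. -/
def colBP (n : ℕ) (j : ℕ) : MvPolynomial (Fin (n - 3)) ℂ :=
  if j = 1 then 0
  else if j = 2 then 1
  else if j = n then 1
  else if h : j - 3 < n - 3 then MvPolynomial.X ⟨j - 3, h⟩ else 0

/-- The Plücker coordinate `p_{ij}` as a polynomial in `ℂ[x_1,…,x_{n-3}]`. -/
def pcP (n : ℕ) (i j : ℕ) : MvPolynomial (Fin (n - 3)) ℂ :=
  colAP n i * colBP n j - colAP n j * colBP n i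

/-- The r-th triple (0-based row index) of the on-shell diagram of `T`. -/
def tripleOf (n : ℕ) (T : TwoTree n) (r : ℕ) : ℕ × ℕ × ℕ :=
  if r + 3 ≤ n - 1 then ((T.par (r + 3)).1, (T.par (r + 3)).2, r + 3) else (1, 2, n)

/-- The matrix `M_T` over `ℂ[x_1,…,x_{n-3}]`, whose row indexed by a triple
`{i,j,k}` (i<j<k) is `p_{jk}·e_i - p_{ik}·e_j + p_{ij}·e_k`. -/
def Mmat (n : ℕ) (T : TwoTree n) :
    Matrix (Fin (n - 2)) (Fin n) (MvPolynomial (Fin (n - 3)) ℂ) :=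
  Matrix.of fun (r : Fin (n - 2)) (c : Fin n) =>
    if (c : ℕ) + 1 = (tripleOf n T r).1 then
      pcP n (tripleOf n T r).2.1 (tripleOf n T r).2.2
    else if (c : ℕ) + 1 = (tripleOf n T r).2.1 then
      -pcP n (tripleOf n T r).1 (tripleOf n T r).2.2
    else if (c : ℕ) + 1 = (tripleOf n T r).2.2 then
      pcP n (tripleOf n T r).1 (tripleOf n T r).2.1
    else 0

/-- The matrix `M_T` evaluated at a point `x ∈ ℂ^{n-3}`. -/
def MmatC (n : ℕ) (T : TwoTree n) (x : Fin (n - 3) → ℂ) : Matrix (Fin (n - 2)) (Fin n) ℂ :=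
  Matrix.of fun (r : Fin (n - 2)) (c : Fin n) =>
    if (c : ℕ) + 1 = (tripleOf n T r).1 then
      pc n x (tripleOf n T r).2.1 (tripleOf n T r).2.2
    else if (c : ℕ) + 1 = (tripleOf n T r).2.1 then
      -pc n x (tripleOf n T r).1 (tripleOf n T r).2.2
    else if (c : ℕ) + 1 = (tripleOf n T r).2.2 then
      pc n x (tripleOf n T r).1 (tripleOf n T r).2.1
    else 0

/-- The 2×n matrix X evaluated at `x`. -/
def Xmat (n : ℕ) (x : Fin (n - 3) → ℂ) : Matrix (Fin 2) (Fin n) ℂ :=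
  Matrix.of fun (r : Fin 2) (c : Fin n) =>
    if r = 0 then colA n ((c : ℕ) + 1) else colB n x ((c : ℕ) + 1)

/-- The monotone embedding `Fin (n-2) → Fin n` skipping the (0-based) positions
`a < b`. -/
def delCols (n a b : ℕ) (d : Fin (n - 2)) : Fin n :=
  ⟨if (d : ℕ) < a then (d : ℕ) else if (d : ℕ) + 1 < b then (d : ℕ) + 1 else (d : ℕ) + 2, by
    have := d.isLt; split_ifs <;> omega⟩

/-- The maximal minor of `M_T` obtained by deleting columns `i < j` (1-based). -/
def maxMinor (n : ℕ) (T : TwoTree n) (i j : ℕ) : MvPolynomial (Fin (n - 3)) ℂ :=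
  Matrix.det (Matrix.of fun (r d : Fin (n - 2)) => Mmat n T r (delCols n (i - 1) (j - 1) d))

/-- `Δ_T = Π_e p_e^{ṽ(e)-1}`. -/
def DeltaT (n : ℕ) (T : TwoTree n) : MvPolynomial (Fin (n - 3)) ℂ :=
  ∏ e ∈ diagEdges n T, pcP n e.1 e.2 ^ (vTil n T e - 1)

/-- `T₀` has, for generic coefficients, exactly one critical point in `U`. -/
def UniqueCritGeneric (n : ℕ) (T₀ : Finset (ℕ × ℕ)) : Prop :=
  ∃ g : MvPolynomial {e : ℕ × ℕ // e ∈ T₀} ℂ, g ≠ 0 ∧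
    ∀ s : ℕ × ℕ → ℂ, MvPolynomial.eval (fun v => s v.1) g ≠ 0 →
      ∃! x : Fin (n - 3) → ℂ, x ∈ Udom n ∧ IsCrit n T₀ s x

/-- `T₀ ⊆ S` exhibits minimal kinematics. -/
def ExhibitsMinKin (n : ℕ) (T₀ : Finset (ℕ × ℕ)) : Prop :=
  T₀ ⊆ Sfin n ∧ UniqueCritGeneric n T₀ ∧
    ∀ T₁ : Finset (ℕ × ℕ), T₁ ⊆ Sfin n → T₀ ⊆ T₁ → UniqueCritGeneric n T₁ → T₁ = T₀

/-- The triangle of `T` created together with the vertex `k`. -/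
def triangle {n : ℕ} (T : TwoTree n) (k : ℕ) : ℕ × ℕ × ℕ := ((T.par k).1, (T.par k).2, k)

lemma mem_edgesUpTo {par : ℕ → ℕ × ℕ} {m : ℕ} {e : ℕ × ℕ} (he : e ∈ edgesUpTo par m) :
    e = (1, 2) ∨ ∃ k, 3 ≤ k ∧ k ≤ m ∧ (e = ((par k).1, k) ∨ e = ((par k).2, k)) := by
  induction m with
  | zero => left; simpa [edgesUpTo] using he
  | succ m ih =>
    rw [edgesUpTo] at he
    split_ifs at he with hm
    · left; simpa using he
    · rw [Finset.mem_union] at he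
      rcases he with he | he
      · rcases ih he with h | ⟨k, h3, hk, h⟩
        · exact Or.inl h
        · exact Or.inr ⟨k, h3, by omega, h⟩
      · exact Or.inr ⟨m + 1, by omega, le_rfl, by simpa using he⟩

lemma TwoTree.one_le_par {n : ℕ} (T : TwoTree n) :
    ∀ k, 3 ≤ k → k ≤ n - 1 → 1 ≤ (T.par k).1 := by
  intro k
  induction k using Nat.strong_induction_on with
  | _ k ih =>
    intro h3 hk
    rcases mem_edgesUpTo (T.mem k h3 hk) with h | ⟨l, h3l, hl, h | h⟩
    · simp [h]
    · rw [h]; exact ih l (by omega) h3l (by omega)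
    · rw [h]
      have := ih l (by omega) h3l (by omega)
      have := (T.lt l h3l (by omega)).1
      simp only
      omega

lemma tripleOf_bounds {n : ℕ} (hn : 4 ≤ n) (T : TwoTree n) (r : Fin (n - 2)) :
    1 ≤ (tripleOf n T r).1 ∧ (tripleOf n T r).1 < (tripleOf n T r).2.1 ∧
      (tripleOf n T r).2.1 < (tripleOf n T r).2.2 ∧ (tripleOf n T r).2.2 = r + 3 := by
  have hr := r.isLt
  unfold tripleOf
  split_ifs with h
  · have := T.lt (r + 3) (by omega) h
    exact ⟨T.one_le_par _ (by omega) h, this.1, this.2, rfl⟩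
  · refine ⟨le_rfl, by simp, ?_, ?_⟩ <;> simp only <;> omega

lemma sum_ite_val_add_one {R : Type*} [CommRing R] {n i : ℕ} (h1 : 1 ≤ i) (hi : i ≤ n)
    (a : R) (f : ℕ → R) :
    ∑ c : Fin n, (if (c : ℕ) + 1 = i then a else 0) * f (c + 1) = a * f i := by
  rw [Finset.sum_eq_single (⟨i - 1, by omega⟩ : Fin n)]
  · have : i - 1 + 1 = i := by omega
    simp [this]
  · intro c _ hc
    have : (c : ℕ) + 1 ≠ i := fun h => hc (Fin.ext (by simp only; omega))
    simp [this]
  · simp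

lemma sum_Mmat_mul {n : ℕ} (hn : 4 ≤ n) (T : TwoTree n) (r : Fin (n - 2))
    (f : ℕ → MvPolynomial (Fin (n - 3)) ℂ) :
    ∑ c : Fin n, Mmat n T r c * f (c + 1) =
      pcP n (tripleOf n T r).2.1 (tripleOf n T r).2.2 * f (tripleOf n T r).1
        - pcP n (tripleOf n T r).1 (tripleOf n T r).2.2 * f (tripleOf n T r).2.1
        + pcP n (tripleOf n T r).1 (tripleOf n T r).2.1 * f (tripleOf n T r).2.2 := by
  obtain ⟨h1, h2, h3, h4⟩ := tripleOf_bounds hn T r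
  have hr := r.isLt
  unfold Mmat
  simp only [Matrix.of_apply]
  generalize tripleOf n T r = t at *
  rw [sub_eq_add_neg, ← neg_mul,
    ← sum_ite_val_add_one (n := n) h1 (by omega) (pcP n t.2.1 t.2.2) f,
    ← sum_ite_val_add_one (n := n) (i := t.2.1) (by omega) (by omega) (-pcP n t.1 t.2.2) f,
    ← sum_ite_val_add_one (n := n) (i := t.2.2) (by omega) (by omega) (pcP n t.1 t.2.1) f,
    ← Finset.sum_add_distrib, ← Finset.sum_add_distrib]
  refine Finset.sum_congr rfl fun c _ => ?_
  rw [← add_mul, ← add_mul]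
  congr 1
  split_ifs <;> first | omega | simp

lemma sum_Mmat_mul_colAP {n : ℕ} (hn : 4 ≤ n) (T : TwoTree n) (r : Fin (n - 2)) :
    ∑ c : Fin n, Mmat n T r c * colAP n (c + 1) = 0 := by
  rw [sum_Mmat_mul hn T r (colAP n)]
  unfold pcP
  ring

lemma sum_Mmat_mul_colBP {n : ℕ} (hn : 4 ≤ n) (T : TwoTree n) (r : Fin (n - 2)) :
    ∑ c : Fin n, Mmat n T r c * colBP n (c + 1) = 0 := by
  rw [sum_Mmat_mul hn T r (colBP n)]
  unfold pcP
  ring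

lemma sum_fin_eq_add_add_sum {R : Type*} [AddCommMonoid R] {n : ℕ} (hn : 2 ≤ n) (f : Fin n → R) :
    ∑ c, f c = f ⟨0, by omega⟩ + (f ⟨1, by omega⟩ + ∑ d : Fin (n - 2), f (delCols n 0 1 d)) := by
  obtain ⟨m, rfl⟩ := Nat.exists_eq_add_of_le' hn
  rw [Fin.sum_univ_succ, Fin.sum_univ_succ]
  rfl

lemma Mmat_eq_mul {n : ℕ} (hn : 4 ≤ n) (T : TwoTree n) :
    ∃ Q : Matrix (Fin (n - 2)) (Fin n) (MvPolynomial (Fin (n - 3)) ℂ),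
      Mmat n T = (Mmat n T).submatrix id (delCols n 0 1) * Q := by
  refine ⟨Matrix.of fun d c =>
    if (c : ℕ) = 0 then colBP n (delCols n 0 1 d + 1) - colAP n (delCols n 0 1 d + 1)
    else if (c : ℕ) = 1 then -colBP n (delCols n 0 1 d + 1)
    else if (c : ℕ) = d + 2 then 1 else 0, ?_⟩
  ext1 r c
  have hA := sum_Mmat_mul_colAP hn T r
  have hB := sum_Mmat_mul_colBP hn T r
  rw [sum_fin_eq_add_add_sum (by omega)] at hA hB
  have h1n : 1 ≠ n := by omega
  have h2n : 2 ≠ n := by omega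
  have hA1 : colAP n 1 = 1 := by simp [colAP, h1n]
  have hA2 : colAP n 2 = 1 := by simp [colAP, h2n]
  have hB1 : colBP n 1 = 0 := by simp [colBP]
  have hB2 : colBP n 2 = 1 := by simp [colBP]
  simp only [zero_add, Nat.reduceAdd, hA1, hA2, hB1, hB2, mul_one, mul_zero] at hA hB
  rw [Matrix.mul_apply]
  simp only [Matrix.submatrix_apply, id, Matrix.of_apply]
  by_cases h0 : (c : ℕ) = 0
  · rw [show c = ⟨0, by omega⟩ from Fin.ext h0]
    simp only [if_true, mul_sub, Finset.sum_sub_distrib]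
    linear_combination hA - hB
  by_cases h1 : (c : ℕ) = 1
  · rw [show c = ⟨1, by omega⟩ from Fin.ext h1]
    simp only [one_ne_zero, if_false, if_true, mul_neg, Finset.sum_neg_distrib]
    linear_combination hB
  · have hc := c.isLt
    simp only [h0, h1, if_false]
    rw [Finset.sum_eq_single (⟨c - 2, by omega⟩ : Fin (n - 2))]
    · have h2 : (c : ℕ) = c - 2 + 2 := by omega
      rw [if_pos h2, mul_one]
      congr 1
      exact Fin.ext (by simpa [delCols] using h2)
    · intro d _ hd
      have : (c : ℕ) ≠ d + 2 := fun h => hd (Fin.ext (by simp only; omega))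
      simp [this]
    · simp

lemma maxMinor_one_two_dvd {n : ℕ} (hn : 4 ≤ n) (T : TwoTree n) (i j : ℕ) :
    maxMinor n T 1 2 ∣ maxMinor n T i j := by
  obtain ⟨Q, hQ⟩ := Mmat_eq_mul hn T
  have key : maxMinor n T i j =
      maxMinor n T 1 2 * (Q.submatrix id (delCols n (i - 1) (j - 1))).det := by
    unfold maxMinor
    rw [← Matrix.det_mul]
    congr 1
    ext1 r d
    simpa [Matrix.mul_apply] using congrFun (congrFun hQ r) (delCols n (i - 1) (j - 1) d)
  exact ⟨_, key⟩

lemma maxMinor_one_two {n : ℕ} (hn : 4 ≤ n) (T : TwoTree n) :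
    maxMinor n T 1 2 = ∏ k ∈ Finset.Icc 3 (n - 1), pcP n (T.par k).1 (T.par k).2 := by
  have entry : ∀ r d : Fin (n - 2), r ≤ d → Mmat n T r (delCols n 0 1 d) =
      if r = d then pcP n (tripleOf n T r).1 (tripleOf n T r).2.1 else 0 := by
    intro r d hrd
    obtain ⟨h1, h2, h3, h4⟩ := tripleOf_bounds hn T r
    have hd : (delCols n 0 1 d : ℕ) = d + 2 := by simp [delCols]
    have hrd' : (r : ℕ) ≤ d := hrd
    simp only [Mmat, Matrix.of_apply, hd, Fin.ext_iff]
    split_ifs <;> first | rfl | omega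
  unfold maxMinor
  rw [Matrix.det_of_isLowerTriangular]
  · simp only [Matrix.of_apply, Nat.sub_self, Nat.reduceSub, entry _ _ le_rfl, if_true]
    rw [Fin.prod_univ_eq_prod_range
      (fun r => pcP n (tripleOf n T r).1 (tripleOf n T r).2.1) (n - 2)]
    have hn2 : n - 2 = n - 3 + 1 := by omega
    have hlast : tripleOf n T (n - 3) = (1, 2, n) := if_neg (by omega)
    have hp : pcP n 1 2 = 1 := by
      have h1n : 1 ≠ n := by omega
      simp [pcP, colAP, colBP, h1n]
    rw [hn2, Finset.prod_range_succ, hlast, hp, mul_one]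
    refine Finset.prod_bij (fun r _ => r + 3) ?_ ?_ ?_ ?_
    · intro r hr
      rw [Finset.mem_range] at hr
      rw [Finset.mem_Icc]
      omega
    · intro a _ b _ h
      omega
    · intro k hk
      rw [Finset.mem_Icc] at hk
      exact ⟨k - 3, by rw [Finset.mem_range]; omega, by omega⟩
    · intro r hr
      rw [Finset.mem_range] at hr
      rw [tripleOf, if_pos (by omega)]
  · intro r d hrd
    have hlt : r < d := hrd
    simpa [hlt.ne] using entry r d hlt.le

lemma mem_triples {n : ℕ} {T : TwoTree n} {t : ℕ × ℕ × ℕ} :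
    t ∈ triples n T ↔ t = (1, 2, n) ∨ ∃ k, (3 ≤ k ∧ k ≤ n - 1) ∧ triangle T k = t := by
  simp [triples, triangle]

lemma triples_injOn {n : ℕ} (hn : 4 ≤ n) {T : TwoTree n} {s t : ℕ × ℕ × ℕ}
    (hs : s ∈ triples n T) (ht : t ∈ triples n T) (h : s.2.2 = t.2.2) : s = t := by
  rcases mem_triples.1 hs with rfl | ⟨k, hk, rfl⟩ <;>
    rcases mem_triples.1 ht with rfl | ⟨l, hl, rfl⟩
  · rfl
  · simp only [triangle] at h; omega
  · simp only [triangle] at h; omega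
  · simp only [triangle] at h; rw [h]

/-- Every edge other than the initial one contains the last vertex of some triple. -/
lemma exists_creating_triple {n : ℕ} {T : TwoTree n} {e : ℕ × ℕ} (he : e ∈ diagEdges n T)
    (h12 : e ≠ (1, 2)) :
    ∃ t ∈ triples n T, e = (t.1, t.2.2) ∨ e = (t.2.1, t.2.2) := by
  simp only [diagEdges, Finset.mem_biUnion, Finset.mem_insert, Finset.mem_singleton] at he
  obtain ⟨t, ht, h | h⟩ := he
  · rcases mem_triples.1 ht with rfl | ⟨k, hk, rfl⟩
    · exact absurd h h12
    · have hpar : e = T.par k := h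
      rcases mem_edgesUpTo (hpar ▸ T.mem k hk.1 hk.2) with h | ⟨l, h3, hl, h⟩
      · exact absurd h h12
      · exact ⟨triangle T l, mem_triples.2 (Or.inr ⟨l, ⟨h3, by omega⟩, rfl⟩), h⟩
  · exact ⟨t, ht, h⟩

lemma vTil_eq {n : ℕ} (hn : 4 ≤ n) (T : TwoTree n) {e : ℕ × ℕ} (he : e ∈ diagEdges n T) :
    vTil n T e = ((Finset.Icc 3 (n - 1)).filter fun k => T.par k = e).card + 1 := by
  have hinj : Function.Injective (triangle T) := fun a b h => congrArg (fun t => t.2.2) h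
  obtain ⟨t₀, ht₀, hin, hpar, huniq⟩ : ∃ t₀ ∈ triples n T, inTriple e t₀ ∧
      (∀ k, 3 ≤ k → k ≤ n - 1 → T.par k = e → triangle T k ≠ t₀) ∧
      ∀ t ∈ triples n T, inTriple e t → t = t₀ ∨ ∃ k, (3 ≤ k ∧ k ≤ n - 1) ∧ T.par k = e ∧
        triangle T k = t := by
    by_cases h12 : e = (1, 2)
    · subst h12
      refine ⟨(1, 2, n), mem_triples.2 (Or.inl rfl), Or.inl rfl, ?_, ?_⟩
      · intro k h3 hk _ h
        have : k = n := congrArg (fun t => t.2.2) h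
        omega
      · intro t ht hin
        rcases mem_triples.1 ht with rfl | ⟨k, hk, rfl⟩
        · exact Or.inl rfl
        · refine Or.inr ⟨k, hk, ?_, rfl⟩
          rcases hin with h | h | h
          · exact h.symm
          · have : 2 = k := congrArg Prod.snd h
            omega
          · have : 2 = k := congrArg Prod.snd h
            omega
    · obtain ⟨t₀, ht₀, h⟩ := exists_creating_triple he h12
      have he2 : e.2 = t₀.2.2 := by rcases h with h | h <;> rw [h]
      refine ⟨t₀, ht₀, Or.inr h, ?_, ?_⟩
      · rintro k h3 hk hpk rfl
        have := (T.lt k h3 hk).2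
        rw [hpk, he2] at this
        exact lt_irrefl _ this
      · intro t ht hin
        rcases hin with h' | h' | h'
        · rcases mem_triples.1 ht with rfl | ⟨k, hk, rfl⟩
          · exact absurd h' h12
          · exact Or.inr ⟨k, hk, h'.symm, rfl⟩
        all_goals exact Or.inl (triples_injOn hn ht ht₀ (by rw [← he2, h']))
  have hset : (triples n T).filter (inTriple e) =
      insert t₀ (((Finset.Icc 3 (n - 1)).filter fun k => T.par k = e).image (triangle T)) := by
    ext t
    simp only [Finset.mem_filter, Finset.mem_insert, Finset.mem_image, Finset.mem_Icc]
    constructor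
    · rintro ⟨ht, h⟩
      rcases huniq t ht h with h | ⟨k, hk, hp, h⟩
      · exact Or.inl h
      · exact Or.inr ⟨k, ⟨hk, hp⟩, h⟩
    · rintro (rfl | ⟨k, ⟨hk, hp⟩, rfl⟩)
      · exact ⟨ht₀, hin⟩
      · exact ⟨mem_triples.2 (Or.inr ⟨k, hk, rfl⟩), Or.inl hp.symm⟩
  rw [vTil, hset, Finset.card_insert_of_notMem, Finset.card_image_of_injective _ hinj]
  simp only [Finset.mem_image, Finset.mem_filter, Finset.mem_Icc]
  rintro ⟨k, ⟨hk, hp⟩, h⟩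
  exact hpar k hk.1 hk.2 hp h

lemma DeltaT_eq {n : ℕ} (hn : 4 ≤ n) (T : TwoTree n) :
    DeltaT n T = ∏ k ∈ Finset.Icc 3 (n - 1), pcP n (T.par k).1 (T.par k).2 := by
  have hmaps : ∀ k ∈ Finset.Icc 3 (n - 1), T.par k ∈ diagEdges n T := by
    intro k hk
    rw [Finset.mem_Icc] at hk
    rw [diagEdges, Finset.mem_biUnion]
    exact ⟨triangle T k, mem_triples.2 (Or.inr ⟨k, hk, rfl⟩), Finset.mem_insert_self _ _⟩
  rw [← Finset.prod_fiberwise_of_maps_to hmaps, DeltaT]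
  refine Finset.prod_congr rfl fun e he => ?_
  rw [vTil_eq hn T he, Nat.add_sub_cancel, ← Finset.prod_const]
  refine Finset.prod_congr (by congr) fun k hk => ?_
  rw [(Finset.mem_filter.1 hk).2]

/-- Lemma 4.2: the gcd of the maximal minors of M_T is, up to a
nonzero constant, Π_e p_e^{ṽ(e)-1}. -/
theorem gcd_of_maximal_minors (n : ℕ) (hn : 4 ≤ n) (T : TwoTree n) :
    (∀ i j : ℕ, 1 ≤ i → i < j → j ≤ n → DeltaT n T ∣ maxMinor n T i j) ∧
      ∀ h : MvPolynomial (Fin (n - 3)) ℂ,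
        (∀ i j : ℕ, 1 ≤ i → i < j → j ≤ n → h ∣ maxMinor n T i j) →
        h ∣ DeltaT n T := by
  have hdet : maxMinor n T 1 2 = DeltaT n T := by rw [maxMinor_one_two hn, DeltaT_eq hn]
  rw [← hdet]
  exact ⟨fun i j _ _ _ => maxMinor_one_two_dvd hn T i j,
    fun h hh => hh 1 2 le_rfl (by omega) (by omega)⟩

end
end MinKin
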